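/- Let (φ_m)_{m≥1} be a sequence of Borel probability measures on [0,1), each absolutely continuous with respect to Lebesgue measure, converging weakly to a Borel probability measure μ on [0,1). Let b ≥ 2 be an integer, and suppose that for every h ∈ ℤ ∖ {0} there exist nonnegative reals c_m(h) with Σ_{m=1}^∞ c_m(h) < ∞ such that, with the convention φ₀ ≡ 0, Σ_{N=1}^∞ N^{−3} Σ_{u=0}^{N−1} Σ_{v=0}^{N−1} | φ̂_m( h b^u (b^v − 1) ) − φ̂_{m−1}( h b^u (b^v − 1) ) | ≤ c_m(h) for every m ≥ 1. Then μ-almost every x ∈ [0,1) is b-normal. -/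

import Mathlib

open MeasureTheory Filter Finset

/-- `e(y) = exp(-2πi y)`. -/
noncomputable def eneg (y : ℝ) : ℂ := Complex.exp (-(2 * Real.pi * Complex.I * (y : ℂ)))

/-- The `n`-th Fourier coefficient of a measure: `ν̂(n) = ∫ e(nx) dν(x)`. -/
noncomputable def muHat (μ : Measure ℝ) (n : ℤ) : ℂ := ∫ x, eneg ((n : ℝ) * x) ∂μ

/-- A measure is Rajchman if its Fourier coefficients tend to `0` as `|n| → ∞`,
i.e. along the cofinite filter on `ℤ`. -/
def Rajchman (μ : Measure ℝ) : Prop :=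
  Tendsto (fun n : ℤ => muHat μ n) cofinite (nhds 0)

/-- The `j`-th digit (for `j ≥ 1`) of the fractional part of `x` in base `b`. -/
noncomputable def digit (b : ℕ) (x : ℝ) (j : ℕ) : ℕ := ⌊Int.fract x * (b : ℝ) ^ j⌋₊ % b

/-- `x` is normal in base `b`: for every `k ≥ 1`, every block of `k` digits occurs with
limiting frequency `b^{-k}` in the base-`b` digit expansion of the fractional part of `x`. -/
def IsNormal (b : ℕ) (x : ℝ) : Prop :=
  ∀ k : ℕ, 1 ≤ k → ∀ d : Fin k → ℕ, (∀ i, d i < b) →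
    Tendsto (fun N : ℕ =>
      (((Finset.Icc 1 N).filter fun n => ∀ i : Fin k, digit b x (n + (i : ℕ)) = d i).card : ℝ) / N)
      atTop (nhds (1 / (b : ℝ) ^ k))

lemma continuous_eneg : Continuous eneg := by
  unfold eneg; fun_prop

lemma norm_eneg (y : ℝ) : ‖eneg y‖ = 1 := by
  unfold eneg
  have : (-(2 * Real.pi * Complex.I * (y : ℂ))) = ((-(2 * Real.pi * y) : ℝ) : ℂ) * Complex.I := by
    push_cast; ring
  rw [this, Complex.norm_exp_ofReal_mul_I]

lemma conj_eneg (y : ℝ) : (starRingEnd ℂ) (eneg y) = eneg (-y) := by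
  unfold eneg
  rw [← Complex.exp_conj]
  congr 1
  have h2 : (starRingEnd ℂ) 2 = 2 := Complex.conj_ofNat 2
  simp [h2]

lemma eneg_mul (x y : ℝ) : eneg x * eneg y = eneg (x + y) := by
  unfold eneg
  rw [← Complex.exp_add]
  congr 1
  push_cast; ring

lemma integrable_eneg (μ : Measure ℝ) [IsFiniteMeasure μ] (a : ℝ) :
    Integrable (fun x => eneg (a * x)) μ := by
  refine Integrable.of_bound (C := 1) ?_ ?_
  · exact (continuous_eneg.comp (continuous_const.mul continuous_id)).aestronglyMeasurable
  · exact Eventually.of_forall fun x => (norm_eneg _).le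

lemma norm_muHat_neg (μ : Measure ℝ) (n : ℤ) : ‖muHat μ (-n)‖ = ‖muHat μ n‖ := by
  have : muHat μ (-n) = (starRingEnd ℂ) (muHat μ n) := by
    unfold muHat
    rw [← integral_conj]
    congr 1
    ext x
    rw [conj_eneg]
    congr 1
    push_cast; ring
  rw [this]
  exact RCLike.norm_conj _

lemma sum_sym_le (N : ℕ) (g : ℕ → ℕ → ℝ) (hg : ∀ j k, 0 ≤ g j k) (hs : ∀ j k, g j k = g k j) :
    ∑ j ∈ range N, ∑ k ∈ range N, g j k ≤
      2 * ∑ u ∈ range N, ∑ v ∈ range N, g (u + v) u := by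
  have key : ∀ k ∈ range N, ∑ j ∈ range N, (if k ≤ j then g j k else 0) ≤
      ∑ v ∈ range N, g (k + v) k := by
    intro k hk
    rw [← Finset.sum_filter]
    have : (range N).filter (fun j => k ≤ j) = Finset.Ico k N := by
      ext j; simp; omega
    rw [this, Finset.sum_Ico_eq_sum_range]
    refine Finset.sum_le_sum_of_subset_of_nonneg ?_ fun _ _ _ => hg _ _
    intro i; simp; omega
  have h1 : ∑ j ∈ range N, ∑ k ∈ range N, g j k ≤
      ∑ j ∈ range N, ∑ k ∈ range N, ((if k ≤ j then g j k else 0) + (if j ≤ k then g k j else 0)) := by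
    refine Finset.sum_le_sum fun j _ => Finset.sum_le_sum fun k _ => ?_
    have := hg j k
    have := hs j k
    split_ifs <;> linarith
  refine h1.trans ?_
  simp only [Finset.sum_add_distrib]
  rw [Finset.sum_comm (f := fun j k => if k ≤ j then g j k else 0), two_mul]
  exact add_le_add (Finset.sum_le_sum key) (Finset.sum_le_sum key)

/-- exponential sum -/
noncomputable def expS (b : ℕ) (h : ℤ) (N : ℕ) (x : ℝ) : ℂ :=
  ∑ n ∈ range N, eneg ((h : ℝ) * (b : ℝ) ^ n * x)

lemma continuous_expS (b : ℕ) (h : ℤ) (N : ℕ) : Continuous (expS b h N) := by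
  unfold expS
  refine continuous_finsetSum _ fun n _ => ?_
  exact continuous_eneg.comp (continuous_const.mul continuous_id)

lemma norm_expS_le (b : ℕ) (h : ℤ) (N : ℕ) (x : ℝ) : ‖expS b h N x‖ ≤ N := by
  unfold expS
  refine (norm_sum_le _ _).trans ?_
  simp [norm_eneg]

lemma integral_expS_le (μ : Measure ℝ) [IsFiniteMeasure μ] (b : ℕ) (h : ℤ) (N : ℕ) :
    ∫ x, ‖expS b h N x‖ ^ 2 ∂μ ≤
      2 * ∑ u ∈ range N, ∑ v ∈ range N, ‖muHat μ (h * (b : ℤ) ^ u * ((b : ℤ) ^ v - 1))‖ := by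
  have h1 : ((∫ x, ‖expS b h N x‖ ^ 2 ∂μ : ℝ) : ℂ) =
      ∑ j ∈ range N, ∑ k ∈ range N, muHat μ (h * (b : ℤ) ^ j - h * (b : ℤ) ^ k) := by
    rw [← integral_complex_ofReal]
    have : ∀ x : ℝ, ((‖expS b h N x‖ ^ 2 : ℝ) : ℂ) = ∑ j ∈ range N, ∑ k ∈ range N,
        eneg (((h * (b : ℤ) ^ j - h * (b : ℤ) ^ k : ℤ) : ℝ) * x) := by
      intro x
      push_cast
      rw [← Complex.mul_conj']
      unfold expS
      rw [map_sum, Finset.sum_mul_sum]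
      refine Finset.sum_congr rfl fun j _ => Finset.sum_congr rfl fun k _ => ?_
      rw [conj_eneg, eneg_mul]
      congr 1
      ring
    simp only [this]
    rw [integral_finsetSum]
    · refine Finset.sum_congr rfl fun j _ => ?_
      rw [integral_finsetSum]
      · rfl
      · intro k _
        exact integrable_eneg μ _
    · intro j _
      exact integrable_finsetSum _ fun k _ => integrable_eneg μ _
  have h2 : ∫ x, ‖expS b h N x‖ ^ 2 ∂μ ≤
      ∑ j ∈ range N, ∑ k ∈ range N, ‖muHat μ (h * (b : ℤ) ^ j - h * (b : ℤ) ^ k)‖ := by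
    have h3 : ∫ x, ‖expS b h N x‖ ^ 2 ∂μ ≤ ‖((∫ x, ‖expS b h N x‖ ^ 2 ∂μ : ℝ) : ℂ)‖ := by
      rw [Complex.norm_real]; exact le_abs_self _
    refine h3.trans ?_
    rw [h1]
    refine (norm_sum_le _ _).trans (Finset.sum_le_sum fun j _ => norm_sum_le _ _)
  refine h2.trans ?_
  refine (sum_sym_le N (fun j k => ‖muHat μ (h * (b : ℤ) ^ j - h * (b : ℤ) ^ k)‖)
    (fun _ _ => norm_nonneg _) ?_).trans (le_of_eq ?_)
  · intro j k
    rw [← norm_muHat_neg]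
    congr 2
    ring
  · congr 1
    refine Finset.sum_congr rfl fun u _ => Finset.sum_congr rfl fun v _ => ?_
    congr 2
    ring

lemma det_lemma (S : ℕ → ℂ) (hS : ∀ n k, ‖S (n + k) - S n‖ ≤ k)
    (hsum : Summable fun N : ℕ => ((N : ℝ) ^ 3)⁻¹ * ‖S N‖ ^ 2) :
    Tendsto (fun N : ℕ => S N / N) atTop (nhds 0) := by
  rw [Metric.tendsto_atTop]
  intro ε' hε'
  obtain ⟨ε, hε, hε1, hεε⟩ : ∃ ε : ℝ, 0 < ε ∧ ε ≤ 1 ∧ ε ≤ ε' :=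
    ⟨min ε' 1, lt_min hε' one_pos, min_le_right _ _, min_le_left _ _⟩
  -- tails
  have hδ : 0 < ε ^ 3 / 64 := by positivity
  obtain ⟨s, hs⟩ := summable_iff_vanishing_norm.1 hsum (ε ^ 3 / 64) hδ
  obtain ⟨N0, hN0⟩ : ∃ N0 : ℕ, ∀ i ∈ s, i < N0 := by
    refine ⟨s.sup id + 1, fun i hi => Nat.lt_succ_of_le (Finset.le_sup (f := id) hi)⟩
  refine ⟨N0 + 1, fun N hN => ?_⟩
  by_contra hcon
  rw [dist_zero_right, norm_div, Complex.norm_natCast, not_lt] at hcon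
  have hNpos : (0 : ℝ) < N := by
    have : 0 < N := by omega
    exact_mod_cast this
  have hSN : ε * N ≤ ‖S N‖ := by
    rw [le_div_iff₀ hNpos] at hcon
    nlinarith
  set K : ℕ := ⌊ε * N / 2⌋₊ with hK
  have hKle : (K : ℝ) ≤ ε * N / 2 := Nat.floor_le (by positivity)
  have hKlt : ε * N / 2 < K + 1 := Nat.lt_floor_add_one _
  have hlow : ∀ k ∈ range (K + 1), ε ^ 2 / (32 * N) ≤
      (((N + k : ℕ) : ℝ) ^ 3)⁻¹ * ‖S (N + k)‖ ^ 2 := by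
    intro k hk
    have hkK : (k : ℝ) ≤ K := by
      have : k ≤ K := by simpa [Nat.lt_succ_iff] using hk
      exact_mod_cast this
    have hk2 : (k : ℝ) ≤ ε * N / 2 := hkK.trans hKle
    have h1 : ε * N / 2 ≤ ‖S (N + k)‖ := by
      have h2 := hS N k
      have h3 : ‖S N‖ ≤ ‖S (N + k)‖ + ‖S (N + k) - S N‖ := by
        rw [norm_sub_rev]
        have := norm_add_le (S (N + k)) (S N - S (N + k))
        simpa using this
      linarith
    have h4 : ((N + k : ℕ) : ℝ) ≤ 2 * N := by
      push_cast
      nlinarith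
    have h5 : (0 : ℝ) < ((N + k : ℕ) : ℝ) := by push_cast; positivity
    calc ε ^ 2 / (32 * N) = ((2 * (N : ℝ)) ^ 3)⁻¹ * (ε * N / 2) ^ 2 := by
          field_simp; norm_num
      _ ≤ _ := by gcongr
  have hdisj : Disjoint (Finset.Ico N (N + (K + 1))) s := by
    rw [Finset.disjoint_left]
    intro i hi his
    have := hN0 i his
    simp at hi
    omega
  have hlt := hs _ hdisj
  rw [Finset.sum_Ico_eq_sum_range, Nat.add_sub_cancel_left] at hlt
  have hge := Finset.card_nsmul_le_sum _ _ _ hlow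
  have hlt' := (le_abs_self _).trans_lt (by simpa only [Real.norm_eq_abs] using hlt)
  rw [card_range, nsmul_eq_mul] at hge
  have : ε ^ 3 / 64 ≤ ((K + 1 : ℕ) : ℝ) * (ε ^ 2 / (32 * N)) := by
    push_cast
    calc ε ^ 3 / 64 = (ε * N / 2) * (ε ^ 2 / (32 * N)) := by field_simp; norm_num
      _ ≤ _ := by gcongr
  linarith

lemma digits_block (b : ℕ) (hb : 2 ≤ b) : ∀ (k : ℕ) (d : Fin k → ℕ), (∀ i, d i < b) →
    ∃ D : ℕ, D < b ^ k ∧ ∀ F : ℕ,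
      (∀ i : Fin k, F / b ^ (k - 1 - (i : ℕ)) % b = d i) ↔ F % b ^ k = D := by
  intro k
  induction k with
  | zero => intro d _; exact ⟨0, by simp, fun F => by simp [Nat.mod_one]⟩
  | succ k ih =>
    intro d hd
    obtain ⟨D, hD, h⟩ := ih (fun i => d i.castSucc) (fun i => hd _)
    have hl := hd (Fin.last k)
    refine ⟨d (Fin.last k) + b * D, ?_, fun F => ?_⟩
    · rw [pow_succ]; nlinarith
    · rw [Fin.forall_fin_succ']
      have e1 : ∀ i : Fin k, F / b ^ (k + 1 - 1 - (i.castSucc : ℕ)) =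
          (F / b) / b ^ (k - 1 - (i : ℕ)) := by
        intro i
        have := i.2
        rw [Nat.div_div_eq_div_mul, ← pow_succ']
        congr 2
        simp; omega
      simp only [e1]
      rw [h (F / b), pow_succ', Nat.mod_mul]
      simp only [Fin.val_last, Nat.add_sub_cancel, Nat.sub_self, pow_zero, Nat.div_one]
      have hm : F % b < b := Nat.mod_lt _ (by omega)
      constructor
      · rintro ⟨h1, h2⟩; rw [h1, h2]
      · intro h1
        have h2 : F % b = d (Fin.last k) := by
          have := congrArg (· % b) h1
          simpa [Nat.add_mul_mod_self_left, Nat.mod_eq_of_lt hl] using this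
        refine ⟨?_, h2⟩
        rw [h2] at h1
        exact Nat.eq_of_mul_eq_mul_left (by omega) (Nat.add_left_cancel h1)

lemma digit_iff (b : ℕ) (hb : 2 ≤ b) (k : ℕ) (d : Fin k → ℕ) (hd : ∀ i, d i < b) :
    ∃ D : ℕ, D < b ^ k ∧ ∀ (x : ℝ) (n : ℕ),
      (∀ i : Fin k, digit b x (n + 1 + (i : ℕ)) = d i) ↔
        Int.fract ((b : ℝ) ^ n * x) ∈ Set.Ico ((D : ℝ) / b ^ k) ((D + 1 : ℝ) / b ^ k) := by
  obtain ⟨D, hD, h⟩ := digits_block b hb k d hd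
  refine ⟨D, hD, fun x n => ?_⟩
  have hb0 : (0 : ℝ) < b := by positivity
  set y := Int.fract x with hy
  have hy0 : 0 ≤ y := Int.fract_nonneg x
  set F := ⌊y * (b : ℝ) ^ (n + k)⌋₊ with hF
  have e1 : ∀ i : Fin k, digit b x (n + 1 + (i : ℕ)) = F / b ^ (k - 1 - (i : ℕ)) % b := by
    intro i
    unfold digit
    congr 1
    rw [hF, ← hy, ← Nat.floor_div_natCast]
    congr 1
    push_cast
    rw [eq_div_iff (by positivity), mul_assoc, ← pow_add]
    congr 2
    have := i.2
    omega
  simp only [e1]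
  rw [h F]
  have hfr : Int.fract ((b : ℝ) ^ n * x) = Int.fract ((b : ℝ) ^ n * y) := by
    rw [Int.fract_eq_fract]
    refine ⟨(b : ℤ) ^ n * ⌊x⌋, ?_⟩
    push_cast
    rw [hy, ← mul_sub, Int.self_sub_fract]
  rw [hfr]
  set t := Int.fract ((b : ℝ) ^ n * y) with ht
  have ht0 : 0 ≤ t := Int.fract_nonneg _
  have ht1 : t < 1 := Int.fract_lt_one _
  have hFe : F = b ^ k * ⌊(b : ℝ) ^ n * y⌋₊ + ⌊t * (b : ℝ) ^ k⌋₊ := by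
    rw [hF]
    have : y * (b : ℝ) ^ (n + k) = t * (b : ℝ) ^ k + ((b ^ k * ⌊(b : ℝ) ^ n * y⌋₊ : ℕ) : ℝ) := by
      push_cast
      rw [natCast_floor_eq_intCast_floor (by positivity), pow_add, ht, Int.fract]
      ring
    rw [this, Nat.floor_add_natCast (by positivity), add_comm]
  have hlt : ⌊t * (b : ℝ) ^ k⌋₊ < b ^ k := by
    rw [Nat.floor_lt (by positivity)]
    push_cast
    have : (0 : ℝ) < (b : ℝ) ^ k := by positivity
    nlinarith
  rw [hFe, Nat.mul_add_mod, Nat.mod_eq_of_lt hlt, Nat.floor_eq_iff (by positivity), Set.mem_Ico,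
    div_le_iff₀ (by positivity), lt_div_iff₀ (by positivity)]

lemma integral_fourier_unit (n : ℤ) :
    ∫ t : UnitAddCircle, fourier n t = if n = 0 then 1 else 0 := by
  have h := congrFun (fourierCoeff_fourier (T := 1) n) 0
  rw [fourierCoeff, AddCircle.integral_haarAddCircle] at h
  simp only [neg_zero, fourier_zero, one_smul, inv_one] at h
  rw [h, Pi.single_apply]
  simp [eq_comm]

lemma weyl_tendsto (P : ℕ → ProbabilityMeasure UnitAddCircle)
    (V : ProbabilityMeasure UnitAddCircle) (hV : (V : Measure UnitAddCircle) = volume)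
    (h : ∀ n : ℤ, n ≠ 0 → Tendsto (fun N => ∫ t, fourier n t ∂(P N : Measure UnitAddCircle))
      atTop (nhds 0)) :
    Tendsto P atTop (nhds V) := by
  have hint : ∀ (Q : ProbabilityMeasure UnitAddCircle) (f : C(UnitAddCircle, ℂ)),
      Integrable f (Q : Measure UnitAddCircle) := by
    intro Q f
    refine Integrable.of_bound (C := ‖f‖) f.continuous.aestronglyMeasurable ?_
    exact Eventually.of_forall fun x => f.norm_coe_le_norm x
  have hspan : ∀ f ∈ Submodule.span ℂ (Set.range (@fourier 1)),
      Tendsto (fun N => ∫ t, f t ∂(P N : Measure UnitAddCircle)) atTop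
        (nhds (∫ t, f t ∂(V : Measure UnitAddCircle))) := by
    intro f hf
    induction hf using Submodule.span_induction with
    | mem f hf =>
      obtain ⟨n, rfl⟩ := hf
      rw [hV, integral_fourier_unit]
      by_cases hn : n = 0
      · subst hn
        simp
      · simpa [hn] using h n hn
    | zero => simp
    | add f g _ _ hf hg =>
      simp only [ContinuousMap.add_apply]
      simp_rw [fun Q => integral_add (hint Q f) (hint Q g)]
      exact hf.add hg
    | smul c f _ hf =>
      simp only [ContinuousMap.smul_apply, integral_smul]
      exact hf.const_smul c
  rw [ProbabilityMeasure.tendsto_iff_forall_integral_rclike_tendsto ℂ]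
  intro f
  have hf : f.toContinuousMap ∈ closure (Submodule.span ℂ (Set.range (@fourier 1)) :
      Set C(UnitAddCircle, ℂ)) := by
    rw [← Submodule.topologicalClosure_coe, span_fourier_closure_eq_top]
    trivial
  rw [Metric.tendsto_atTop]
  intro ε hε
  obtain ⟨g, hg, hfg⟩ := Metric.mem_closure_iff.1 hf (ε / 3) (by positivity)
  obtain ⟨N0, hN0⟩ := Metric.tendsto_atTop.1 (hspan g hg) (ε / 3) (by positivity)
  have hd : ∀ Q : ProbabilityMeasure UnitAddCircle,
      dist (∫ t, f t ∂(Q : Measure UnitAddCircle)) (∫ t, g t ∂(Q : Measure UnitAddCircle))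
        ≤ dist f.toContinuousMap g := by
    intro Q
    have hsub := integral_sub (hint Q f.toContinuousMap) (hint Q g)
    simp only [BoundedContinuousFunction.coe_toContinuousMap] at hsub
    rw [dist_eq_norm, ← hsub]
    refine (norm_integral_le_of_norm_le_const (C := dist f.toContinuousMap g)
      (Eventually.of_forall fun x => ?_)).trans (by simp)
    rw [← dist_eq_norm]
    exact ContinuousMap.dist_apply_le_dist (f := f.toContinuousMap) x
  refine ⟨N0, fun N hN => ?_⟩
  have h1 := hd (P N)
  have h2 := hd V
  have h3 := hN0 N hN
  rw [dist_comm] at h2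
  have h4 := dist_triangle4 (∫ t, f t ∂(P N : Measure UnitAddCircle))
    (∫ t, g t ∂(P N : Measure UnitAddCircle)) (∫ t, g t ∂(V : Measure UnitAddCircle))
    (∫ t, f t ∂(V : Measure UnitAddCircle))
  linarith

/-- the arc -/
def arc (α β : ℝ) : Set UnitAddCircle := (fun x : ℝ => (x : UnitAddCircle)) '' Set.Ico α β

lemma mem_arc (α β : ℝ) (h0 : 0 ≤ α) (h1 : β ≤ 1) (x : ℝ) :
    (x : UnitAddCircle) ∈ arc α β ↔ Int.fract x ∈ Set.Ico α β := by
  unfold arc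
  constructor
  · rintro ⟨y, hy, hyx⟩
    rw [← AddCircle.coe_fract x] at hyx
    have := (AddCircle.coe_eq_coe_iff_of_mem_Ico (p := (1:ℝ)) (a := 0)
      (x := y) (y := Int.fract x) ⟨h0.trans hy.1, by linarith [hy.2]⟩
      ⟨Int.fract_nonneg x, by linarith [Int.fract_lt_one x]⟩).1 hyx
    rwa [← this]
  · intro h
    exact ⟨_, h, AddCircle.coe_fract x⟩

lemma measurableSet_arc (α β : ℝ) : MeasurableSet (arc α β) := by
  by_cases h : α < β
  · unfold arc
    rw [← Set.Ioo_insert_left h, Set.image_insert_eq]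
    exact ((QuotientAddGroup.isOpenMap_coe _ isOpen_Ioo).measurableSet).insert _
  · simp [arc, Set.Ico_eq_empty h]

lemma volume_arc (α β : ℝ) (h0 : 0 ≤ α) (h1 : β ≤ 1) :
    volume (arc α β) = ENNReal.ofReal (β - α) := by
  rw [← (UnitAddCircle.measurePreserving_mk 0).measure_preimage
    (measurableSet_arc α β).nullMeasurableSet]
  have : (fun x : ℝ => (x : UnitAddCircle)) ⁻¹' (arc α β) =ᵐ[volume.restrict (Set.Ioc (0:ℝ) (0+1))]
      Set.Ico α β := by
    have h : ∀ᵐ x ∂(volume.restrict (Set.Ioc (0:ℝ) (0+1))), x ≠ 1 :=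
      ae_restrict_of_ae (Measure.ae_ne volume 1)
    filter_upwards [h, ae_restrict_mem measurableSet_Ioc] with x hx hx2
    have hf : Int.fract x = x := Int.fract_eq_self.2
      ⟨hx2.1.le, lt_of_le_of_ne (by simpa using hx2.2) hx⟩
    apply propext
    change (x : UnitAddCircle) ∈ arc α β ↔ x ∈ Set.Ico α β
    rw [mem_arc _ _ h0 h1, hf]
  rw [measure_congr this, Measure.restrict_congr_set (Ico_ae_eq_Ioc).symm,
    Measure.restrict_apply measurableSet_Ico, zero_add, Set.inter_eq_left.2 ?_, Real.volume_Ico]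
  exact Set.Ico_subset_Ico h0 h1

lemma frontier_arc (α β : ℝ) : volume (frontier (arc α β)) = 0 := by
  have hq : Continuous (fun x : ℝ => (x : UnitAddCircle)) := AddCircle.continuous_mk' 1
  have hsub : frontier (arc α β) ⊆ (fun x : ℝ => (x : UnitAddCircle)) '' {α, β} := by
    intro t ht
    have hc : closure (arc α β) ⊆ (fun x : ℝ => (x : UnitAddCircle)) '' Set.Icc α β :=
      closure_minimal (Set.image_mono Set.Ico_subset_Icc_self)
        (isCompact_Icc.image hq).isClosed
    have hi : (fun x : ℝ => (x : UnitAddCircle)) '' Set.Ioo α β ⊆ interior (arc α β) :=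
      interior_maximal (Set.image_mono Set.Ioo_subset_Ico_self)
        (QuotientAddGroup.isOpenMap_coe _ isOpen_Ioo)
    obtain ⟨x, hx, rfl⟩ := hc ht.1
    refine ⟨x, ?_, rfl⟩
    by_contra hne
    simp only [Set.mem_insert_iff, Set.mem_singleton_iff, not_or] at hne
    exact ht.2 (hi ⟨x, ⟨lt_of_le_of_ne hx.1 (Ne.symm hne.1), lt_of_le_of_ne hx.2 hne.2⟩, rfl⟩)
  have hpt : ∀ t : UnitAddCircle, volume ({t} : Set UnitAddCircle) = 0 := by
    intro t
    rw [← Metric.closedBall_zero, AddCircle.volume_closedBall]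
    simp
  refine measure_mono_null hsub ?_
  rw [Set.image_pair, Set.insert_eq]
  exact measure_union_null (hpt _) (hpt _)

noncomputable def avgM (a : ℕ → UnitAddCircle) (N : ℕ) : Measure UnitAddCircle :=
  ((N : ENNReal) + 1)⁻¹ • ∑ n ∈ range (N + 1), Measure.dirac (a n)

lemma avgM_prob (a : ℕ → UnitAddCircle) (N : ℕ) : IsProbabilityMeasure (avgM a N) := by
  constructor
  simp only [avgM, Measure.smul_apply, Measure.finsetSum_apply, measure_univ, sum_const, card_range,
    smul_eq_mul, nsmul_eq_mul, mul_one]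
  push_cast
  exact ENNReal.inv_mul_cancel (by simp) (by simp)

lemma integral_avgM (a : ℕ → UnitAddCircle) (N : ℕ) (f : UnitAddCircle → ℂ) :
    ∫ t, f t ∂(avgM a N) = (∑ n ∈ range (N + 1), f (a n)) / ((N + 1 : ℕ) : ℂ) := by
  unfold avgM
  rw [integral_smul_measure, integral_finsetSum_measure]
  · simp only [integral_dirac]
    have : (((N : ENNReal) + 1)⁻¹).toReal = ((N + 1 : ℕ) : ℝ)⁻¹ := by
      rw [ENNReal.toReal_inv]
      norm_cast
    rw [this, Complex.real_smul, div_eq_inv_mul]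
    push_cast
    rfl
  · intro i _
    exact integrable_dirac (by simp)

lemma avgM_apply (a : ℕ → UnitAddCircle) (N : ℕ) (E : Set UnitAddCircle) (hE : MeasurableSet E)
    [DecidablePred fun n => a n ∈ E] :
    (avgM a N E).toReal = (((range (N + 1)).filter fun n => a n ∈ E).card : ℝ) / ((N + 1 : ℕ) : ℝ) := by
  simp only [avgM, Measure.smul_apply, Measure.finsetSum_apply, Measure.dirac_apply' _ hE]
  have : ∀ n, E.indicator (1 : UnitAddCircle → ENNReal) (a n) = if a n ∈ E then 1 else 0 := by
    intro n; simp [Set.indicator_apply]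
  simp only [this, Finset.sum_boole]
  rw [smul_eq_mul, ENNReal.toReal_mul, ENNReal.toReal_inv, div_eq_inv_mul]
  norm_cast

lemma isNormal_of_expS (b : ℕ) (hb : 2 ≤ b) (x : ℝ)
    (h : ∀ n : ℤ, n ≠ 0 → Tendsto (fun N : ℕ => expS b n N x / N) atTop (nhds 0)) :
    IsNormal b x := by
  classical
  intro k _ d hd
  obtain ⟨D, hD, hdig⟩ := digit_iff b hb k d hd
  have hbk : (0 : ℝ) < (b : ℝ) ^ k := by positivity
  set α : ℝ := (D : ℝ) / b ^ k with hα
  set β : ℝ := (D + 1 : ℝ) / b ^ k with hβ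
  have h0 : 0 ≤ α := by positivity
  have h1 : β ≤ 1 := by
    rw [hβ, div_le_one hbk]
    exact_mod_cast hD
  let a : ℕ → UnitAddCircle := fun n => (((b : ℝ) ^ n * x : ℝ) : UnitAddCircle)
  let P : ℕ → ProbabilityMeasure UnitAddCircle := fun N => ⟨avgM a N, avgM_prob a N⟩
  let V : ProbabilityMeasure UnitAddCircle := ⟨volume, ⟨UnitAddCircle.measure_univ⟩⟩
  have hP : Tendsto P atTop (nhds V) := by
    refine weyl_tendsto P V rfl fun n hn => ?_
    have h2 := (tendsto_add_atTop_iff_nat 1).2 (h (-n) (by simpa using hn))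
    refine h2.congr fun N => ?_
    change _ = ∫ t, fourier n t ∂(avgM a N)
    rw [integral_avgM]
    congr 1
    unfold expS
    refine Finset.sum_congr rfl fun j _ => ?_
    simp only [a]
    rw [fourier_coe_apply, eneg]
    congr 1
    push_cast
    ring
  have hE := ProbabilityMeasure.tendsto_measure_of_null_frontier_of_tendsto' hP
    (E := arc α β) (frontier_arc α β)
  have hE2 := (ENNReal.tendsto_toReal (by
    change volume (arc α β) ≠ _
    exact measure_ne_top _ _)).comp hE
  change Tendsto _ _ (nhds (volume (arc α β)).toReal) at hE2
  have hβα : β - α = 1 / (b : ℝ) ^ k := by rw [hα, hβ]; ring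
  rw [volume_arc α β h0 h1, hβα, ENNReal.toReal_ofReal (by positivity)] at hE2
  rw [← tendsto_add_atTop_iff_nat 1]
  refine hE2.congr fun N => ?_
  change (avgM a N (arc α β)).toReal = _
  rw [avgM_apply a N _ (measurableSet_arc α β)]
  congr 2
  refine Finset.card_bij (fun n _ => n + 1) ?_ ?_ ?_
  · intro n hn
    simp only [mem_filter, mem_range, Finset.mem_Icc] at hn ⊢
    refine ⟨by omega, (hdig x n).2 ?_⟩
    exact (mem_arc α β h0 h1 _).1 hn.2
  · intro n _ m _ hnm
    simpa using hnm
  · intro m hm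
    simp only [mem_filter, mem_range, Finset.mem_Icc] at hm
    obtain ⟨n, rfl⟩ : ∃ n, m = n + 1 := ⟨m - 1, by omega⟩
    refine ⟨n, ?_, rfl⟩
    simp only [mem_filter, mem_range]
    exact ⟨by omega, (mem_arc α β h0 h1 _).2 ((hdig x n).1 hm.2)⟩

lemma tendsto_muHat (φ : ℕ → Measure ℝ) (μ : Measure ℝ)
    (hprob : ∀ m : ℕ, 1 ≤ m → IsProbabilityMeasure (φ m)) (hμ : IsProbabilityMeasure μ)
    (hweak : ∀ f : ℝ → ℝ, Continuous f →
      Tendsto (fun m : ℕ => ∫ x, f x ∂(φ m)) atTop (nhds (∫ x, f x ∂μ))) (n : ℤ) :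
    Tendsto (fun m => muHat (φ m) n) atTop (nhds (muHat μ n)) := by
  have hc : Continuous fun x : ℝ => eneg ((n : ℝ) * x) :=
    continuous_eneg.comp (continuous_const.mul continuous_id)
  have hr := hweak _ (Complex.continuous_re.comp hc)
  have hi := hweak _ (Complex.continuous_im.comp hc)
  have key : ∀ ν : Measure ℝ, IsProbabilityMeasure ν → muHat ν n =
      ((∫ x, (Complex.re ∘ fun x : ℝ => eneg ((n : ℝ) * x)) x ∂ν : ℝ) : ℂ) +
      ((∫ x, (Complex.im ∘ fun x : ℝ => eneg ((n : ℝ) * x)) x ∂ν : ℝ) : ℂ) * Complex.I := by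
    intro ν _
    exact (integral_re_add_im (integrable_eneg ν n)).symm
  rw [key μ hμ]
  refine Tendsto.congr' ?_ ((Complex.continuous_ofReal.tendsto _ |>.comp hr).add
    ((Complex.continuous_ofReal.tendsto _ |>.comp hi).mul_const Complex.I))
  filter_upwards [eventually_ge_atTop 1] with m hm
  rw [key _ (hprob m hm)]
  rfl

lemma ae_tendsto_expS (φ : ℕ → Measure ℝ) (μ : Measure ℝ)
    (hφ0 : φ 0 = 0)
    (hprob : ∀ m : ℕ, 1 ≤ m → IsProbabilityMeasure (φ m)) (hμ : IsProbabilityMeasure μ)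
    (hweak : ∀ f : ℝ → ℝ, Continuous f →
      Tendsto (fun m : ℕ => ∫ x, f x ∂(φ m)) atTop (nhds (∫ x, f x ∂μ)))
    (b : ℕ) (h : ℤ) (c : ℕ → ℝ) (hc0 : ∀ m, 0 ≤ c m) (hc : Summable c)
    (hsum : ∀ m : ℕ, 1 ≤ m → ∀ M : ℕ,
        ∑ N ∈ Finset.Icc 1 M, ((N : ℝ) ^ 3)⁻¹ *
          ∑ u ∈ Finset.range N, ∑ v ∈ Finset.range N,
            ‖muHat (φ m) (h * (b : ℤ) ^ u * ((b : ℤ) ^ v - 1)) -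
              muHat (φ (m - 1)) (h * (b : ℤ) ^ u * ((b : ℤ) ^ v - 1))‖ ≤ c m) :
    ∀ᵐ x ∂μ, Tendsto (fun N : ℕ => expS b h N x / N) atTop (nhds 0) := by
  have hz : ∀ n, muHat (φ 0) n = 0 := by intro n; simp [muHat, hφ0]
  -- partial bound
  have hK : ∀ M K : ℕ, ∑ N ∈ Finset.Icc 1 M, ((N : ℝ) ^ 3)⁻¹ *
      ∑ u ∈ range N, ∑ v ∈ range N, ‖muHat (φ K) (h * (b : ℤ) ^ u * ((b : ℤ) ^ v - 1))‖ ≤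
      ∑ m ∈ range (K + 1), c m := by
    intro M K
    induction K with
    | zero => simpa [hz] using hc0 0
    | succ K ih =>
      rw [Finset.sum_range_succ]
      refine le_trans ?_ (add_le_add ih (hsum (K + 1) (by omega) M))
      rw [← Finset.sum_add_distrib]
      refine Finset.sum_le_sum fun N _ => ?_
      rw [← mul_add]
      refine mul_le_mul_of_nonneg_left ?_ (by positivity)
      rw [← Finset.sum_add_distrib]
      refine Finset.sum_le_sum fun u _ => ?_
      rw [← Finset.sum_add_distrib]
      refine Finset.sum_le_sum fun v _ => ?_
      rw [Nat.add_sub_cancel]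
      have := norm_add_le (muHat (φ K) (h * (b : ℤ) ^ u * ((b : ℤ) ^ v - 1)))
        (muHat (φ (K + 1)) (h * (b : ℤ) ^ u * ((b : ℤ) ^ v - 1)) -
          muHat (φ K) (h * (b : ℤ) ^ u * ((b : ℤ) ^ v - 1)))
      simpa using this
  have hlim : ∀ M : ℕ, ∑ N ∈ Finset.Icc 1 M, ((N : ℝ) ^ 3)⁻¹ *
      ∑ u ∈ range N, ∑ v ∈ range N, ‖muHat μ (h * (b : ℤ) ^ u * ((b : ℤ) ^ v - 1))‖ ≤
      ∑' m, c m := by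
    intro M
    refine le_of_tendsto (x := atTop) (f := fun K => ∑ N ∈ Finset.Icc 1 M, ((N : ℝ) ^ 3)⁻¹ *
      ∑ u ∈ range N, ∑ v ∈ range N, ‖muHat (φ K) (h * (b : ℤ) ^ u * ((b : ℤ) ^ v - 1))‖) ?_
      (Eventually.of_forall fun K => (hK M K).trans (hc.sum_le_tsum _ fun i _ => hc0 i))
    refine tendsto_finsetSum _ fun N _ => Tendsto.const_mul _ ?_
    refine tendsto_finsetSum _ fun u _ => tendsto_finsetSum _ fun v _ => ?_
    exact (tendsto_muHat φ μ hprob hμ hweak _).norm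
  -- integrated series
  let F : ℕ → ℝ → ℝ := fun N x => ((N : ℝ) ^ 3)⁻¹ * ‖expS b h N x‖ ^ 2
  have hF0 : ∀ N x, 0 ≤ F N x := fun N x => by positivity
  have hFc : ∀ N, Continuous (F N) := fun N =>
    continuous_const.mul ((continuous_expS b h N).norm.pow 2)
  have hFi : ∀ N, Integrable (F N) μ := by
    intro N
    refine Integrable.of_bound (C := ((N : ℝ) ^ 3)⁻¹ * (N : ℝ) ^ 2)
      (hFc N).aestronglyMeasurable (Eventually.of_forall fun x => ?_)
    rw [Real.norm_of_nonneg (hF0 N x)]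
    have := norm_expS_le b h N x
    simp only [F]
    gcongr
  have hFint : ∀ N, ∫ x, F N x ∂μ ≤ 2 * (((N : ℝ) ^ 3)⁻¹ *
      ∑ u ∈ range N, ∑ v ∈ range N, ‖muHat μ (h * (b : ℤ) ^ u * ((b : ℤ) ^ v - 1))‖) := by
    intro N
    simp only [F]
    rw [integral_const_mul, mul_left_comm]
    exact mul_le_mul_of_nonneg_left (integral_expS_le μ b h N) (by positivity)
  have hbd : ∀ M, ∑ N ∈ range M, ∫ x, F N x ∂μ ≤ 2 * ∑' m, c m := by
    intro M
    have h1 : ∑ N ∈ range M, ∫ x, F N x ∂μ ≤ ∑ N ∈ Finset.Icc 1 M, ∫ x, F N x ∂μ := by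
      have h2 : ∑ N ∈ range M, ∫ x, F N x ∂μ ≤ ∑ N ∈ insert 0 (Finset.Icc 1 M), ∫ x, F N x ∂μ := by
        refine Finset.sum_le_sum_of_subset_of_nonneg ?_ fun N _ _ => integral_nonneg (hF0 N)
        intro i hi
        simp only [mem_range, mem_insert, Finset.mem_Icc] at hi ⊢
        omega
      rw [Finset.sum_insert (by simp)] at h2
      simpa [F] using h2
    refine h1.trans ((Finset.sum_le_sum fun N _ => hFint N).trans ?_)
    rw [← Finset.mul_sum]
    exact mul_le_mul_of_nonneg_left (hlim M) (by norm_num)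
  have hS : Summable fun N => ∫ x, F N x ∂μ :=
    summable_of_sum_range_le (fun N => integral_nonneg (hF0 N)) hbd
  have hlt : ∫⁻ x, ∑' N, ENNReal.ofReal (F N x) ∂μ ≠ ⊤ := by
    rw [lintegral_tsum fun N => (hFc N).measurable.ennreal_ofReal.aemeasurable]
    have : ∀ N, ∫⁻ x, ENNReal.ofReal (F N x) ∂μ = ENNReal.ofReal (∫ x, F N x ∂μ) := fun N =>
      (ofReal_integral_eq_lintegral_ofReal (hFi N) (Eventually.of_forall (hF0 N))).symm
    simp only [this]
    exact hS.tsum_ofReal_ne_top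
  have hae := ae_lt_top' (AEMeasurable.ennreal_tsum
    fun N => (hFc N).measurable.ennreal_ofReal.aemeasurable) hlt
  filter_upwards [hae] with x hx
  refine det_lemma (fun N => expS b h N x) ?_ ?_
  · intro n k
    simp only [expS]
    rw [Finset.sum_range_add, add_sub_cancel_left]
    refine (norm_sum_le _ _).trans ?_
    simp [norm_eneg]
  · have := ENNReal.summable_toReal hx.ne
    simpa only [ENNReal.toReal_ofReal (hF0 _ x)] using this

/-- Corollary 10.3 (Pramanik–Zhang), a Davenport–Erdős–LeVeque type criterion: if
absolutely continuous probability measures `φ_m` on `[0,1)` converge weakly to `μ`,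
and for every `h ≠ 0` the triple sums of Fourier-coefficient differences are bounded
by a summable sequence `c_m` (with the convention `φ₀ ≡ 0`), then `μ`-almost every
point is `b`-normal. -/
theorem DEL_criterion_for_normality (φ : ℕ → Measure ℝ) (μ : Measure ℝ)
    (hφ0 : φ 0 = 0)
    (hprob : ∀ m : ℕ, 1 ≤ m → IsProbabilityMeasure (φ m))
    (hac : ∀ m : ℕ, 1 ≤ m → φ m ≪ MeasureTheory.volume)
    (hsupp : ∀ m : ℕ, 1 ≤ m → φ m ((Set.Ico (0:ℝ) 1)ᶜ) = 0)
    (hμ : IsProbabilityMeasure μ) (hμsupp : μ ((Set.Ico (0:ℝ) 1)ᶜ) = 0)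
    (hweak : ∀ f : ℝ → ℝ, Continuous f →
      Tendsto (fun m : ℕ => ∫ x, f x ∂(φ m)) atTop (nhds (∫ x, f x ∂μ)))
    (b : ℕ) (hb : 2 ≤ b)
    (hsum : ∀ h : ℤ, h ≠ 0 → ∃ c : ℕ → ℝ, (∀ m, 0 ≤ c m) ∧ Summable c ∧
      ∀ m : ℕ, 1 ≤ m → ∀ M : ℕ,
        ∑ N ∈ Finset.Icc 1 M, ((N : ℝ) ^ 3)⁻¹ *
          ∑ u ∈ Finset.range N, ∑ v ∈ Finset.range N,
            ‖muHat (φ m) (h * (b : ℤ) ^ u * ((b : ℤ) ^ v - 1)) -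
              muHat (φ (m - 1)) (h * (b : ℤ) ^ u * ((b : ℤ) ^ v - 1))‖ ≤ c m) :
    ∀ᵐ x ∂μ, IsNormal b x := by
  have hall : ∀ h : ℤ, ∀ᵐ x ∂μ, h ≠ 0 →
      Tendsto (fun N : ℕ => expS b h N x / N) atTop (nhds 0) := by
    intro h
    by_cases hh : h = 0
    · exact Eventually.of_forall fun x hx => absurd hh hx
    · obtain ⟨c, hc0, hc, hcs⟩ := hsum h hh
      filter_upwards [ae_tendsto_expS φ μ hφ0 hprob hμ hweak b h c hc0 hc hcs] with x hx _
      exact hx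
  filter_upwards [ae_all_iff.2 hall] with x hx
  exact isNormal_of_expS b hb x hx
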